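/- No deterministic strategy-proof mechanism provides a constant factor approximation of the Nash welfare: for every real ρ ≥ 1 there exists n such that for every strategy-proof mechanism f : [0,1]^n → [0,1] there is a profile x ∈ [0,1]^n and a Nash optimum y* for x with Nash(y*, x) > ρ·Nash(f(x), x). -/

import Mathlib

open Set

noncomputable section

/-- Utility of an agent at location `z` when the facility is at `y`. -/
def util (y z : ℝ) : ℝ := 1 - |y - z|

/-- Nash welfare: product of agents' utilities. -/
def nash {n : ℕ} (y : ℝ) (x : Fin n → ℝ) : ℝ := ∏ i, util y (x i)

/-- `y` is a Nash optimum for the profile `x`. -/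
def isNashOpt {n : ℕ} (x : Fin n → ℝ) (y : ℝ) : Prop :=
  y ∈ Set.Icc (0 : ℝ) 1 ∧ ∀ z ∈ Set.Icc (0 : ℝ) 1, nash z x ≤ nash y x

/-- A profile of agent locations lies in `[0,1]^n`. -/
def inProfile {n : ℕ} (x : Fin n → ℝ) : Prop := ∀ i, x i ∈ Set.Icc (0 : ℝ) 1

/-- A deterministic mechanism is strategy-proof if no agent can increase her
utility by misreporting her location. -/
def strategyProof {n : ℕ} (f : (Fin n → ℝ) → ℝ) : Prop :=
  ∀ x : Fin n → ℝ, inProfile x → ∀ i : Fin n, ∀ xi' ∈ Set.Icc (0 : ℝ) 1,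
    util (f (Function.update x i xi')) (x i) ≤ util (f x) (x i)

/-- Replacing one report by the chosen location does not change the outcome. -/
lemma strategyProof.apply_update_apply {n : ℕ} {f : (Fin n → ℝ) → ℝ} (hf : strategyProof f)
    (hmem : ∀ x, inProfile x → f x ∈ Set.Icc (0 : ℝ) 1) {x : Fin n → ℝ} (hx : inProfile x)
    (i : Fin n) : f (Function.update x i (f x)) = f x := by
  have hx' : inProfile (Function.update x i (f x)) := by
    intro j
    by_cases hj : j = i
    · subst hj
      simpa using hmem x hx
    · simpa [Function.update_of_ne hj] using hx j
  have h := hf _ hx' i (x i) (hx i)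
  simp only [Function.update_idem, Function.update_eq_self, Function.update_self, util, sub_self,
    abs_zero] at h
  have h0 : |f (Function.update x i (f x)) - f x| = 0 :=
    le_antisymm (by linarith) (abs_nonneg _)
  linarith [abs_eq_zero.mp h0]

/-- Replacing any set of reports by the chosen location does not change the outcome. -/
lemma strategyProof.apply_eq_of_forall_eq_or {n : ℕ} {f : (Fin n → ℝ) → ℝ} (hf : strategyProof f)
    (hmem : ∀ x, inProfile x → f x ∈ Set.Icc (0 : ℝ) 1) {x z : Fin n → ℝ} (hx : inProfile x)
    (hz : ∀ i, z i = x i ∨ z i = f x) : f z = f x := by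
  classical
  have key (s : Finset (Fin n)) : f (s.piecewise (fun _ => f x) x) = f x := by
    induction s using Finset.induction_on with
    | empty => simp
    | insert j s _ ih =>
      have hs : inProfile (s.piecewise (fun _ => f x) x) := by
        intro i
        by_cases hi : i ∈ s
        · simpa [hi] using hmem x hx
        · simpa [hi] using hx i
      have h := hf.apply_update_apply hmem hs j
      rw [ih] at h
      rw [Finset.piecewise_insert, h]
  have hzs : z = (Finset.univ.filter fun i => z i = f x).piecewise (fun _ => f x) x := by
    funext i
    by_cases hi : z i = f x
    · simp [Finset.piecewise, hi]
    · simpa [Finset.piecewise, hi] using (hz i).resolve_right hi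
  rw [hzs]
  exact key _

/-- The profile with `m` agents at `a` and `m` agents at `b`. -/
def twoPoint (m : ℕ) (a b : ℝ) : Fin (m + m) → ℝ := Fin.append (fun _ => a) (fun _ => b)

lemma twoPoint_castAdd {m : ℕ} (a b : ℝ) (i : Fin m) : twoPoint m a b (Fin.castAdd m i) = a :=
  Fin.append_left _ _ i

lemma twoPoint_natAdd {m : ℕ} (a b : ℝ) (i : Fin m) : twoPoint m a b (Fin.natAdd m i) = b :=
  Fin.append_right _ _ i

lemma forall_twoPoint {m : ℕ} {P : Fin (m + m) → ℝ → Prop} {a b : ℝ}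
    (ha : ∀ i, P (Fin.castAdd m i) a) (hb : ∀ i, P (Fin.natAdd m i) b) (i : Fin (m + m)) :
    P i (twoPoint m a b i) := by
  refine Fin.addCases (fun i => ?_) (fun i => ?_) i
  · simpa only [twoPoint_castAdd] using ha i
  · simpa only [twoPoint_natAdd] using hb i

lemma inProfile_twoPoint {m : ℕ} {a b : ℝ} (ha : a ∈ Set.Icc (0 : ℝ) 1)
    (hb : b ∈ Set.Icc (0 : ℝ) 1) : inProfile (twoPoint m a b) :=
  forall_twoPoint (P := fun _ t => t ∈ Set.Icc (0 : ℝ) 1) (fun _ => ha) (fun _ => hb)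

lemma nash_twoPoint (m : ℕ) (a b y : ℝ) :
    nash y (twoPoint m a b) = (util y a * util y b) ^ m := by
  simp only [nash, Fin.prod_univ_add, twoPoint_castAdd, twoPoint_natAdd, Finset.prod_const,
    Finset.card_univ, Fintype.card_fin, mul_pow]

lemma util_nonneg {y z : ℝ} (hy : y ∈ Set.Icc (0 : ℝ) 1) (hz : z ∈ Set.Icc (0 : ℝ) 1) :
    0 ≤ util y z := by
  have : |y - z| ≤ 1 := abs_le.mpr ⟨by linarith [hy.1, hz.2], by linarith [hy.2, hz.1]⟩
  unfold util
  linarith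

lemma util_mul_util_midpoint (a b : ℝ) :
    util ((a + b) / 2) a * util ((a + b) / 2) b = (1 - |a - b| / 2) ^ 2 := by
  have h1 : (a + b) / 2 - a = -((a - b) / 2) := by ring
  have h2 : (a + b) / 2 - b = (a - b) / 2 := by ring
  rw [util, util, h1, h2, abs_neg, abs_div, abs_two]
  ring

/-- With equally many agents at two points, the midpoint is a Nash optimum. -/
lemma isNashOpt_twoPoint {m : ℕ} {a b : ℝ} (ha : a ∈ Set.Icc (0 : ℝ) 1)
    (hb : b ∈ Set.Icc (0 : ℝ) 1) : isNashOpt (twoPoint m a b) ((a + b) / 2) := by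
  refine ⟨⟨by linarith [ha.1, hb.1], by linarith [ha.2, hb.2]⟩, fun z hz => ?_⟩
  rw [nash_twoPoint, nash_twoPoint, util_mul_util_midpoint]
  have h1 := util_nonneg hz ha
  have h2 := util_nonneg hz hb
  refine pow_le_pow_left₀ (mul_nonneg h1 h2) ?_ m
  have h3 : util z a + util z b ≤ 2 - |a - b| := by
    have := abs_sub_le a z b
    rw [abs_sub_comm a z] at this
    unfold util
    linarith
  nlinarith [sq_nonneg (util z a - util z b)]

/-- If two groups of `m` agents are at distance at least `1 / 2`, the location of either one is
worse than the midpoint by a factor exponential in `m`. -/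
lemma nash_twoPoint_gap {m : ℕ} {ρ a b c : ℝ} (hm : ρ < (17 / 16) ^ m)
    (hρ : 1 ≤ ρ) (ha : a ∈ Set.Icc (0 : ℝ) 1) (hb : b ∈ Set.Icc (0 : ℝ) 1)
    (hab : 1 / 2 ≤ |a - b|) (hc : c = a ∨ c = b) :
    nash ((a + b) / 2) (twoPoint m a b) > ρ * nash c (twoPoint m a b) := by
  have hd : |a - b| ≤ 1 := abs_le.mpr ⟨by linarith [ha.1, hb.2], by linarith [ha.2, hb.1]⟩
  have hcu : util c a * util c b = 1 - |a - b| := by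
    rcases hc with rfl | rfl
    · simp [util]
    · simp [util, abs_sub_comm]
  rw [nash_twoPoint, nash_twoPoint, util_mul_util_midpoint, hcu]
  generalize |a - b| = d at hab hd
  rcases hd.eq_or_lt with rfl | hd
  · have hm0 : m ≠ 0 := by
      rintro rfl
      norm_num at hm
      linarith
    simp only [sub_self, zero_pow hm0, mul_zero]
    positivity
  · have hpos : 0 < (1 - d) ^ m := pow_pos (by linarith) m
    calc ρ * (1 - d) ^ m < (17 / 16) ^ m * (1 - d) ^ m := by gcongr
      _ = (17 / 16 * (1 - d)) ^ m := (mul_pow _ _ _).symm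
      _ ≤ ((1 - d / 2) ^ 2) ^ m := pow_le_pow_left₀ (by linarith) (by nlinarith) m

theorem no_sp_constant_nash_approx :
    ∀ ρ : ℝ, 1 ≤ ρ → ∃ n : ℕ, ∀ f : (Fin n → ℝ) → ℝ,
      (∀ x, inProfile x → f x ∈ Set.Icc (0 : ℝ) 1) → strategyProof f →
      ∃ x : Fin n → ℝ, inProfile x ∧
        ∃ ystar, isNashOpt x ystar ∧ nash ystar x > ρ * nash (f x) x := by
  intro ρ hρ
  obtain ⟨m, hm⟩ := pow_unbounded_of_one_lt ρ (by norm_num : (1 : ℝ) < 17 / 16)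
  refine ⟨m + m, fun f hmem hf => ?_⟩
  have h0 : (0 : ℝ) ∈ Set.Icc (0 : ℝ) 1 := by simp
  have h1 : (1 : ℝ) ∈ Set.Icc (0 : ℝ) 1 := by simp
  have hx : inProfile (twoPoint m 0 1) := inProfile_twoPoint h0 h1
  have hc := hmem _ hx
  set c := f (twoPoint m 0 1)
  rcases le_total (1 / 2) c with h | h
  · have hfz : f (twoPoint m 0 c) = c :=
      hf.apply_eq_of_forall_eq_or hmem hx
        (forall_twoPoint (P := fun i t => t = twoPoint m 0 1 i ∨ t = c)
          (fun i => Or.inl (twoPoint_castAdd 0 1 i).symm) (fun _ => Or.inr rfl))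
    refine ⟨_, inProfile_twoPoint h0 hc, _, isNashOpt_twoPoint h0 hc, ?_⟩
    rw [hfz]
    refine nash_twoPoint_gap hm hρ h0 hc ?_ (Or.inr rfl)
    rw [abs_sub_comm]
    exact le_abs.mpr (Or.inl (by linarith))
  · have hfz : f (twoPoint m c 1) = c :=
      hf.apply_eq_of_forall_eq_or hmem hx
        (forall_twoPoint (P := fun i t => t = twoPoint m 0 1 i ∨ t = c)
          (fun _ => Or.inr rfl) (fun i => Or.inl (twoPoint_natAdd 0 1 i).symm))
    refine ⟨_, inProfile_twoPoint hc h1, _, isNashOpt_twoPoint hc h1, ?_⟩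
    rw [hfz]
    refine nash_twoPoint_gap hm hρ hc h1 ?_ (Or.inl rfl)
    exact le_abs.mpr (Or.inr (by linarith))
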